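/- Let I ⊂ K[x_1,...,x_n] be a polymatroidal ideal generated in degree d. Then I^{(dk)} ⊂ I^k for all k ≥ 1, where I^{(t)} denotes the t-th symbolic power of I. -/

import Mathlib

open MvPolynomial

noncomputable section

variable (K : Type) [Field K]

/-- The monomial prime ideal `p_F` generated by the variables `x_i`, `i ∈ F`. -/
def monomialPrimeIdeal {n : ℕ} (F : Finset (Fin n)) : Ideal (MvPolynomial (Fin n) K) :=
  Ideal.span ((fun i => (X i : MvPolynomial (Fin n) K)) '' F)

/-- A monomial ideal: an ideal generated by monomials. -/
def IsMonomialIdeal {σ : Type*} (I : Ideal (MvPolynomial σ K)) : Prop :=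
  ∃ A : Set (σ →₀ ℕ), I = Ideal.span ((fun u => (monomial u (1 : K))) '' A)

/-- The graded maximal ideal of a polynomial ring. -/
def maxIdeal (σ : Type*) : Ideal (MvPolynomial σ K) :=
  Ideal.span (Set.range (X : σ → MvPolynomial σ K))

/-- The monomial localization map `S → S(p_F)`, sending `x_i ↦ x_i` for `i ∈ F`
and `x_i ↦ 1` otherwise. -/
def monomialLocalizationMap {n : ℕ} (F : Finset (Fin n)) :
    MvPolynomial (Fin n) K →+* MvPolynomial {i : Fin n // i ∈ F} K :=
  (aeval (fun i : Fin n =>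
    if h : i ∈ F then (X ⟨i, h⟩ : MvPolynomial {i : Fin n // i ∈ F} K) else 1)).toRingHom

/-- The monomial localization `I(p_F) ⊆ S(p_F)` of a monomial ideal `I`. -/
def mLoc {n : ℕ} (I : Ideal (MvPolynomial (Fin n) K)) (F : Finset (Fin n)) :
    Ideal (MvPolynomial {i : Fin n // i ∈ F} K) :=
  I.map (monomialLocalizationMap K F)

/-- `min(J)`: the minimal degree of a nonzero homogeneous element of `J`, which for a
graded ideal is the minimal degree of a generator. -/
def minGenDeg {σ : Type*} (J : Ideal (MvPolynomial σ K)) : ℕ :=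
  sInf {d : ℕ | ∃ f ∈ J, f ≠ 0 ∧ MvPolynomial.IsHomogeneous f d}

/-- `max(Soc(S/J))`: the maximal degree of a nonzero homogeneous element of the
socle `(J : m)/J` of `S/J`. -/
def maxSocleDeg {σ : Type*} (J : Ideal (MvPolynomial σ K)) : ℕ :=
  sSup {d : ℕ | ∃ f : MvPolynomial σ K, f ∉ J ∧ MvPolynomial.IsHomogeneous f d ∧
    ∀ i : σ, X i * f ∈ J}

/-- `I` is of intersection type: `I` is an intersection of (positive) powers of
monomial prime ideals. -/
def IsIntersectionType {n : ℕ} (I : Ideal (MvPolynomial (Fin n) K)) : Prop :=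
  ∃ (r : ℕ) (F : Fin r → Finset (Fin n)) (d : Fin r → ℕ),
    (∀ i, 0 < d i) ∧ I = ⨅ i, (monomialPrimeIdeal K (F i)) ^ (d i)

/-- A finite graded free resolution of an ideal `I ⊆ S = K[x_i : i ∈ σ]`:
`⋯ → F_1 → F_0 → I → 0`, where `F_i` is a finite graded free module with basis `ι i`
whose basis element `b` sits in degree `deg i b`, the maps are graded of degree `0`,
and the complex is exact with the augmentation `F_0 → S` having image `I`. -/
structure GradedFreeResolution (σ : Type) [Fintype σ] (I : Ideal (MvPolynomial σ K)) where
  ι : ℕ → Type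
  finite : ∀ i, Finite (ι i)
  deg : ∀ i, ι i → ℕ
  aug : (ι 0 →₀ MvPolynomial σ K) →ₗ[MvPolynomial σ K] MvPolynomial σ K
  d : ∀ i, (ι (i + 1) →₀ MvPolynomial σ K) →ₗ[MvPolynomial σ K] (ι i →₀ MvPolynomial σ K)
  aug_range : ∀ f : MvPolynomial σ K, f ∈ LinearMap.range aug ↔ f ∈ I
  exact_zero : LinearMap.range (d 0) = LinearMap.ker aug
  exact : ∀ i, LinearMap.range (d (i + 1)) = LinearMap.ker (d i)
  aug_homog : ∀ b : ι 0, MvPolynomial.IsHomogeneous (aug (Finsupp.single b 1)) (deg 0 b)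
  d_homog : ∀ (i : ℕ) (b : ι (i + 1)) (a : ι i),
    (d i (Finsupp.single b 1)) a = 0 ∨
      ∃ m, deg (i + 1) b = deg i a + m ∧
        MvPolynomial.IsHomogeneous ((d i (Finsupp.single b 1)) a) m

/-- The Castelnuovo–Mumford regularity of an ideal `I` of a polynomial ring: the least
`r` such that `I` admits a (finite) graded free resolution whose `i`-th free module is
generated in degrees `≤ r + i`; for a finitely generated graded ideal this is the value
computed from the minimal graded free resolution. -/
def reg {σ : Type} [Fintype σ] (I : Ideal (MvPolynomial σ K)) : ℕ :=
  sInf {r : ℕ | ∃ R : GradedFreeResolution K σ I, ∀ (i : ℕ) (b : R.ι i), R.deg i b ≤ r + i}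

/-- `I` is generated in the single degree `t`. -/
def GeneratedInSingleDegree {σ : Type} (I : Ideal (MvPolynomial σ K)) (t : ℕ) : Prop :=
  ∃ A : Set (MvPolynomial σ K), (∀ f ∈ A, MvPolynomial.IsHomogeneous f t) ∧ I = Ideal.span A

/-- `I` has a linear resolution: it is generated in a single degree `t` and its
Castelnuovo–Mumford regularity equals `t`. -/
def HasLinearResolution {σ : Type} [Fintype σ] (I : Ideal (MvPolynomial σ K)) : Prop :=
  ∃ t : ℕ, GeneratedInSingleDegree K I t ∧ reg K I = t

/-- A discrete polymatroid on the ground set `[n]`: a nonempty finite set of integer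
vectors in `ℤ_{≥0}^n` closed under componentwise minimization and satisfying the
exchange property. -/
structure DiscretePolymatroid (n : ℕ) where
  carrier : Finset (Fin n →₀ ℕ)
  nonempty : carrier.Nonempty
  lower : ∀ u ∈ carrier, ∀ v : Fin n →₀ ℕ, v ≤ u → v ∈ carrier
  exchange : ∀ u ∈ carrier, ∀ v ∈ carrier, (∑ i, u i) < (∑ i, v i) →
    ∃ i : Fin n, u i < v i ∧ u + Finsupp.single i 1 ∈ carrier

namespace DiscretePolymatroid

variable {n : ℕ} (P : DiscretePolymatroid n)

/-- The rank of `P`: the maximal modulus `|u| = ∑ i, u i` of an element of `P`. -/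
def rank : ℕ := P.carrier.sup fun u => ∑ i, u i

/-- The set of bases of `P`: the elements of maximal modulus. -/
def bases : Finset (Fin n →₀ ℕ) := P.carrier.filter fun u => (∑ i, u i) = P.rank

/-- The polymatroidal ideal associated with `P`: the ideal generated by the monomials
`x^u`, `u` a basis of `P`. -/
def toIdeal (K : Type) [Field K] : Ideal (MvPolynomial (Fin n) K) :=
  Ideal.span ((fun u => (monomial u (1 : K))) '' (P.bases : Set (Fin n →₀ ℕ)))

/-- The ground set rank function `ρ` of `P`: `ρ(F) = max {u(F) : u ∈ B(P)}`. -/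
def rkFun (F : Finset (Fin n)) : ℕ := P.bases.sup fun u => ∑ i ∈ F, u i

/-- The complementary rank function `τ(F) = d - ρ([n] \ F)`. -/
def crkFun (F : Finset (Fin n)) : ℕ := P.rank - P.rkFun Fᶜ

end DiscretePolymatroid

/-- The (unique) primary component of `I` at a minimal prime `p`:
`∪_{s ∉ p} (I : s)`. -/
def primaryComponentAt {R : Type*} [CommRing R] (I p : Ideal R) : Ideal R :=
  ⨆ (s : R) (_ : s ∉ p), Submodule.colon I (Ideal.span {s})

/-- The `t`-th symbolic power of `I`: the intersection of the `t`-th powers of the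
uniquely determined primary components of `I` at its minimal primes. -/
def symbolicPower {R : Type*} [CommRing R] (I : Ideal R) (t : ℕ) : Ideal R :=
  ⨅ p ∈ I.minimalPrimes, (primaryComponentAt I p) ^ t

theorem monomialPrimeIdeal_isPrime {n : ℕ} (F : Finset (Fin n)) :
    (monomialPrimeIdeal K F).IsPrime := by
  classical
  let φ : MvPolynomial (Fin n) K →ₐ[K] MvPolynomial (Fin n) K :=
    aeval fun i => if i ∈ F then 0 else X i
  have hmk : (Ideal.Quotient.mkₐ K (monomialPrimeIdeal K F)).comp φ =
      Ideal.Quotient.mkₐ K (monomialPrimeIdeal K F) := by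
    refine algHom_ext fun i => ?_
    by_cases hi : i ∈ F
    · have hX : (X i : MvPolynomial (Fin n) K) ∈ monomialPrimeIdeal K F :=
        Ideal.subset_span ⟨i, hi, rfl⟩
      simpa [φ, hi] using (Ideal.Quotient.eq_zero_iff_mem.2 hX).symm
    · simp [φ, hi]
  have hker : monomialPrimeIdeal K F = RingHom.ker φ := by
    refine le_antisymm (Ideal.span_le.2 ?_) fun f hf => ?_
    · rintro _ ⟨i, hi, rfl⟩
      have hi' : i ∈ F := hi
      simp [RingHom.mem_ker, φ, hi']
    · have hf0 : φ f = 0 := hf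
      have := DFunLike.congr_fun hmk f
      rw [AlgHom.comp_apply, hf0, map_zero] at this
      exact Ideal.Quotient.eq_zero_iff_mem.1 this.symm
  rw [hker]
  exact RingHom.ker_isPrime φ

/-- A polynomial lying in the `m`-th power of a monomial prime has all its monomials of
degree at least `m` in the variables generating that prime. -/
theorem le_sum_of_mem_monomialPrimeIdeal_pow {n : ℕ} (F : Finset (Fin n)) (m : ℕ)
    {f : MvPolynomial (Fin n) K} (hf : f ∈ monomialPrimeIdeal K F ^ m)
    {a : Fin n →₀ ℕ} (ha : a ∈ f.support) : m ≤ ∑ i ∈ F, a i := by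
  have hle : monomialPrimeIdeal K F ^ m ≤
      Ideal.span ((fun u => monomial u (1 : K)) '' {u : Fin n →₀ ℕ | m ≤ ∑ i ∈ F, u i}) := by
    clear hf
    induction m with
    | zero =>
      refine le_top.trans (top_le_iff.2 ((Ideal.eq_top_iff_one _).2 ?_))
      exact Ideal.subset_span ⟨0, by simp, rfl⟩
    | succ m ih =>
      rw [pow_succ]
      refine (Ideal.mul_mono_left ih).trans ?_
      rw [monomialPrimeIdeal, Ideal.span_mul_span', Ideal.span_le]
      rintro _ ⟨_, ⟨u, hu, rfl⟩, _, ⟨i, hi, rfl⟩, rfl⟩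
      refine Ideal.subset_span ⟨u + Finsupp.single i 1, ?_, ?_⟩
      · have hi' : i ∈ F := hi
        simpa [Finset.sum_add_distrib, Finsupp.single_apply, hi'] using hu
      · simp [X, monomial_mul]
  obtain ⟨u, hu, hua⟩ := mem_ideal_span_monomial_image.1 (hle hf) a ha
  exact le_trans hu (Finset.sum_le_sum fun i _ => hua i)

/-- The primary component of an ideal at a prime containing it lies in that prime. -/
theorem primaryComponentAt_le {R : Type*} [CommRing R] {I p : Ideal R} [hp : p.IsPrime]
    (hIp : I ≤ p) : primaryComponentAt I p ≤ p := by
  refine iSup₂_le fun s hs r hr => ?_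
  have hrs : r * s ∈ I := by
    simpa using Submodule.mem_colon.1 hr s (Ideal.mem_span_singleton_self s)
  exact (hp.mem_or_mem (hIp hrs)).resolve_right hs

/-- Symbolic powers of an ideal lie in the powers of every prime containing it. -/
theorem symbolicPower_le_pow {R : Type*} [CommRing R] {I p : Ideal R} [p.IsPrime]
    (hIp : I ≤ p) (t : ℕ) : symbolicPower I t ≤ p ^ t := by
  obtain ⟨q, hq, hqp⟩ := Ideal.exists_minimalPrimes_le hIp
  have := hq.1.1
  exact (iInf₂_le q hq).trans
    (Ideal.pow_right_mono ((primaryComponentAt_le hq.1.2).trans hqp) t)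

namespace DiscretePolymatroid

variable {n : ℕ} (P : DiscretePolymatroid n)

theorem sum_le_rank {u : Fin n →₀ ℕ} (hu : u ∈ P.carrier) : ∑ i, u i ≤ P.rank :=
  Finset.le_sup (f := fun u : Fin n →₀ ℕ => ∑ i, u i) hu

theorem bases_nonempty : P.bases.Nonempty := by
  obtain ⟨u, hu, h⟩ := Finset.exists_mem_eq_sup P.carrier P.nonempty fun u => ∑ i, u i
  exact ⟨u, Finset.mem_filter.2 ⟨hu, h.symm⟩⟩

theorem zero_mem_carrier : 0 ∈ P.carrier := by
  obtain ⟨u, hu⟩ := P.nonempty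
  exact P.lower u hu 0 zero_le

/-- If `a` has degree at least `k * P.rank` on every set meeting the support of every basis,
then `a` dominates a sum of `k` bases. -/
theorem exists_bases_sum_le (k : ℕ) (a : Fin n →₀ ℕ)
    (ha : ∀ F : Finset (Fin n), (∀ u ∈ P.bases, ∃ i ∈ F, u i ≠ 0) →
      P.rank * k ≤ ∑ i ∈ F, a i) :
    ∃ v : Fin k → Fin n →₀ ℕ, (∀ j, v j ∈ P.bases) ∧ ∑ j, v j ≤ a := by
  classical
  obtain ⟨v, hv, hmax⟩ := Finset.exists_max_image
    ((Fintype.piFinset fun _ : Fin k => P.carrier).filter fun v => ∑ j, v j ≤ a)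
    (fun v => ∑ j, ∑ i, v j i) ⟨0, by simp [P.zero_mem_carrier]⟩
  simp only [Finset.mem_filter, Fintype.mem_piFinset] at hv hmax
  refine ⟨v, fun j => Finset.mem_filter.2 ⟨hv.1 j, ?_⟩, hv.2⟩
  by_contra hj
  have hlt : ∑ i, v j i < P.rank := lt_of_le_of_ne (P.sum_le_rank (hv.1 j)) hj
  set F := Finset.univ.filter fun i => v j + Finsupp.single i 1 ∈ P.carrier with hF
  have hcover : ∀ u ∈ P.bases, ∃ i ∈ F, u i ≠ 0 := by
    intro u hu
    obtain ⟨hu, hur⟩ := Finset.mem_filter.1 hu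
    obtain ⟨i, hi, hvi⟩ := P.exchange _ (hv.1 j) u hu (hur ▸ hlt)
    exact ⟨i, by simpa [hF] using hvi, by omega⟩
  have hsat : ∀ i ∈ F, a i ≤ ∑ l, v l i := by
    intro i hi
    by_contra! hai
    set w := Function.update v j (v j + Finsupp.single i 1) with hw
    have hwv : w = v + Pi.single j (Finsupp.single i 1) := by
      ext l
      by_cases hl : l = j
      · subst hl; simp [hw]
      · simp [hw, hl]
    have hsum : ∑ l, w l = ∑ l, v l + Finsupp.single i 1 := by
      simp [hwv, Finset.sum_add_distrib]
    have hwa : ∑ l, w l ≤ a := by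
      rw [hsum]
      intro i'
      have := hv.2 i'
      by_cases h : i' = i
      · subst h
        simpa [Finsupp.finsetSum_apply] using hai
      · simpa [Finsupp.single_apply, Ne.symm h] using this
    have hwP : ∀ l, w l ∈ P.carrier := by
      intro l
      by_cases hl : l = j
      · subst hl
        simpa [hw, hF] using hi
      · simpa [hw, hl] using hv.1 l
    have hle := hmax w ⟨hwP, hwa⟩
    have hcomm : ∀ x : Fin k → Fin n →₀ ℕ, ∑ l, ∑ i, x l i = ∑ i, (∑ l, x l) i := by
      intro x
      rw [Finset.sum_comm]
      simp [Finsupp.finsetSum_apply]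
    rw [hcomm, hcomm, hsum] at hle
    simp [Finset.sum_add_distrib] at hle
  have hbound : ∑ l, ∑ i, v l i < P.rank * k := by
    calc ∑ l, ∑ i, v l i < ∑ _l : Fin k, P.rank :=
          Finset.sum_lt_sum (fun l _ => P.sum_le_rank (hv.1 l)) ⟨j, Finset.mem_univ j, hlt⟩
      _ = P.rank * k := by simp [mul_comm]
  have hle : ∑ i ∈ F, a i ≤ ∑ l, ∑ i, v l i := by
    calc ∑ i ∈ F, a i ≤ ∑ i ∈ F, ∑ l, v l i := Finset.sum_le_sum hsat
      _ ≤ ∑ i, ∑ l, v l i := Finset.sum_le_sum_of_subset (Finset.subset_univ F)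
      _ = ∑ l, ∑ i, v l i := Finset.sum_comm
  exact absurd (ha F hcover) (by omega)

/-- The common degree of the generators of a polymatroidal ideal is at least the rank. -/
theorem rank_le_of_generatedInSingleDegree {d : ℕ}
    (hd : GeneratedInSingleDegree K (P.toIdeal K) d) : P.rank ≤ d := by
  obtain ⟨A, hA, hspan⟩ := hd
  obtain ⟨u, hu⟩ := P.bases_nonempty
  obtain ⟨f, hfA, hf⟩ : ∃ f ∈ A, f ≠ 0 := by
    by_contra! h
    have hmem : monomial u (1 : K) ∈ P.toIdeal K := Ideal.subset_span ⟨u, hu, rfl⟩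
    rw [hspan, Ideal.span_eq_bot.2 h] at hmem
    simp at hmem
  obtain ⟨a, ha⟩ := support_nonempty.2 hf
  have hfI : f ∈ P.toIdeal K := hspan ▸ Ideal.subset_span hfA
  obtain ⟨w, hw, hwa⟩ := mem_ideal_span_monomial_image.1 hfI a ha
  have hdeg := (hA f hfA).degree_eq_sum_deg_support ha
  calc P.rank = ∑ i, w i := (Finset.mem_filter.1 hw).2.symm
    _ ≤ ∑ i, a i := Finset.sum_le_sum fun i _ => hwa i
    _ = d := by rw [hdeg, Finset.sum_subset (Finset.subset_univ a.support) (by simp)]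

theorem toIdeal_le_monomialPrimeIdeal {F : Finset (Fin n)}
    (hF : ∀ u ∈ P.bases, ∃ i ∈ F, u i ≠ 0) : P.toIdeal K ≤ monomialPrimeIdeal K F := by
  refine Ideal.span_le.2 ?_
  rintro _ ⟨u, hu, rfl⟩
  refine mem_ideal_span_X_image.2 fun m hm => ?_
  obtain rfl : m = u := by simpa using support_monomial_subset hm
  exact hF m hu

end DiscretePolymatroid

/-- Let `I` be a polymatroidal ideal generated in degree `d`. Then
`I^{(dk)} ⊆ I^k` for all `k ≥ 1`. -/
theorem polymatroidal_symbolic_power_subset {n : ℕ} (P : DiscretePolymatroid n)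
    (I : Ideal (MvPolynomial (Fin n) K)) (hI : I = P.toIdeal K)
    (d : ℕ) (hd : GeneratedInSingleDegree K I d) :
    ∀ k : ℕ, 1 ≤ k → symbolicPower I (d * k) ≤ I ^ k := by
  intro k _ f hf
  subst hI
  rw [f.as_sum]
  refine Ideal.sum_mem _ fun a ha => ?_
  obtain ⟨v, hv, hva⟩ := P.exists_bases_sum_le k a fun F hF => by
    have := monomialPrimeIdeal_isPrime K F
    exact (Nat.mul_le_mul_right k (P.rank_le_of_generatedInSingleDegree K hd)).trans
      (le_sum_of_mem_monomialPrimeIdeal_pow K F _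
        (symbolicPower_le_pow (P.toIdeal_le_monomialPrimeIdeal K hF) _ hf) ha)
  obtain ⟨b, rfl⟩ := exists_add_of_le hva
  have hprod : ∏ j, monomial (v j) (1 : K) ∈ P.toIdeal K ^ k := by
    have := Ideal.prod_mem_prod (s := Finset.univ) (I := fun _ : Fin k => P.toIdeal K)
      (x := fun j => monomial (v j) (1 : K)) fun j _ => Ideal.subset_span ⟨v j, hv j, rfl⟩
    simpa using this
  rw [← monomial_sum_one] at hprod
  simpa [monomial_mul] using Ideal.mul_mem_right (monomial b (coeff (∑ j, v j + b) f)) _ hprod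

end
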